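/- Let S be a real random variable, P ≥ 1 a real number and m > 2 an integer. Then for all integers k with 1 ≤ k ≤ m, the integral I_k(P) = P^{-(m-1)m/2} ∫_{-P^{m-1}}^{P^{m-1}} ... ∫_{-1}^{1} |E exp{2πi(α_m S^m + ... + α_1 S)} 1_{{-P < S ≤ P}}|^{2k} dα_m ... dα_1 satisfies I_k(P) ≤ M_k P^{(3k-1)/2} ( sup_I P(S ∈ I) )^{2k}, where M_k is a constant depending only on k and m, and the supremum is taken over all half-open intervals I = {x : a < x ≤ a+1} of length 1 with arbitrary real a. -/

import Mathlib

open MeasureTheory Real Set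

/-- The quantity `I_k(P)` from the stochastic Vinogradov mean value theorem:
`I_k(P) = P^{-(m-1)m/2} ∫_{-P^{m-1}}^{P^{m-1}} ⋯ ∫_{-1}^{1}
  |E exp(2πi(α_m S^m + ⋯ + α₁ S)) 1_{-P < S ≤ P}|^{2k} dα_m ⋯ dα₁`,
for a random variable `S` with distribution `μ`.  Coordinate `j : Fin m` of the integration
variable corresponds to the coefficient `α_{j+1}`, ranging over `[-P^j, P^j]`. -/
noncomputable def Ik (μ : Measure ℝ) (m k : ℕ) (P : ℝ) : ℝ :=
  P ^ (-(((m : ℝ) - 1) * m / 2)) *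
    ∫ α in Set.univ.pi (fun j : Fin m => Set.Icc (-(P ^ (j : ℕ))) (P ^ (j : ℕ))),
      ‖∫ s, Set.indicator (Set.Ioc (-P) P)
          (fun s' => Complex.exp (2 * (Real.pi : ℂ) * Complex.I *
            ((∑ j : Fin m, α j * s' ^ ((j : ℕ) + 1) : ℝ) : ℂ))) s ∂μ‖ ^ (2 * k)


lemma aux_coef (P : ℝ) (hP : 1 ≤ P) (u c : ℕ → ℝ) (hu : ∀ l, |u l| ≤ 1) (hc : ∀ l, |c l| ≤ P) (q : ℕ) :
    ∃ γ : ℕ → ℝ, (∀ x, ∏ l ∈ Finset.range q, (u l * x + c l) = ∑ i ∈ Finset.range (q+1), γ i * x ^ i)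
      ∧ (∀ i, q < i → γ i = 0) ∧ ∀ i ≤ q, |γ i| ≤ 2 ^ q * P ^ (q - i) := by
  induction q with
  | zero =>
    refine ⟨fun i => if i = 0 then 1 else 0, by simp, ?_, ?_⟩
    · intro i hi
      simp; omega
    · intro i hi
      have : i = 0 := by omega
      simp [this]
  | succ q ih =>
    obtain ⟨γ, h1, h2, h3⟩ := ih
    refine ⟨fun i => c q * γ i + u q * (if i = 0 then 0 else γ (i - 1)), ?_, ?_, ?_⟩
    · intro x
      rw [Finset.prod_range_succ, h1]
      simp only [add_mul, Finset.sum_add_distrib]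
      rw [Finset.sum_range_succ (fun i => c q * γ i * x ^ i), h2 (q+1) (by omega),
        Finset.sum_range_succ' (fun i => u q * (if i = 0 then 0 else γ (i - 1)) * x ^ i)]
      simp only [Nat.add_eq_zero_iff, one_ne_zero, and_false, if_false, Nat.add_sub_cancel, if_true]
      rw [Finset.sum_mul]
      simp only [mul_add, Finset.sum_add_distrib]
      have e1 : ∑ i ∈ Finset.range (q+1), γ i * x ^ i * (u q * x) = ∑ i ∈ Finset.range (q+1), u q * γ i * x ^ (i+1) := by
        apply Finset.sum_congr rfl; intros; ring
      have e2 : ∑ i ∈ Finset.range (q+1), γ i * x ^ i * (c q) = ∑ i ∈ Finset.range (q+1), c q * γ i * x ^ (i) := by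
        apply Finset.sum_congr rfl; intros; ring
      rw [e1, e2]; ring
    · intro i hi
      have : i ≠ 0 := by omega
      simp [h2 i (by omega), h2 (i-1) (by omega)]
    · intro i hi
      have b1 : |c q * γ i| ≤ 2 ^ q * P ^ (q + 1 - i) := by
        by_cases h : i ≤ q
        · rw [abs_mul, show q + 1 - i = (q - i) + 1 by omega, pow_succ]
          calc _ ≤ P * (2 ^ q * P ^ (q-i)) := by
                gcongr
                · exact hc q
                · exact h3 i h
            _ = _ := by ring
        · rw [h2 i (by omega)]; simp; positivity
      have b2 : |u q * (if i = 0 then 0 else γ (i - 1))| ≤ 2 ^ q * P ^ (q + 1 - i) := by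
        by_cases h : i = 0
        · simp [h]; positivity
        · simp only [h, if_false]
          rw [abs_mul, show q + 1 - i = q - (i - 1) by omega]
          calc _ ≤ 1 * (2 ^ q * P ^ (q-(i-1))) := by
                gcongr
                · exact hu q
                · exact h3 _ (by omega)
            _ = _ := by ring
      calc _ ≤ _ := abs_add_le _ _
        _ ≤ _ := add_le_add b1 b2
        _ = _ := by ring

lemma aux_sorted (q r : ℕ) (P ρ T : ℝ) (hP : 1 ≤ P) (hρ : 0 ≤ ρ) (s t : ℕ → ℝ)
    (hs : Monotone s) (ht : Monotone t) (s1 : ∀ i, ρ ≤ s i) (s2 : ∀ i, s i ≤ P)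
    (t1 : ∀ i, ρ ≤ t i) (t2 : ∀ i, t i ≤ P)
    (hT : ∀ j, j < q + 1 + r → P ^ j * |∑ i ∈ Finset.range (q+1), (s i ^ (j+1) - t i ^ (j+1))| ≤ T)
    (i : ℕ) (hi : i < q + 1) :
    P ^ r * (ρ ^ r * (|s i - t i| / 4) ^ q * (|s i - t i| / 2)) ≤ (q + 1) * 2 ^ q * T * P ^ q := by
  set σ : ℕ → ℝ := fun i => if t i ≤ s i then 1 else -1 with hσ
  have hσσ : ∀ i, σ i * σ i = 1 := by
    intro i; simp only [hσ]; split_ifs <;> norm_num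
  have hσv : ∀ i, σ i = 1 ∨ σ i = -1 := by
    intro i; simp only [hσ]; split_ifs <;> simp
  set u : ℕ → ℝ := fun l => if σ l = σ (l+1) then 1 else -1 with hu
  set c : ℕ → ℝ := fun l => if σ l = σ (l+1) then P else max (s l) (t l) with hc
  have hul : ∀ l, u l = σ l * σ (l+1) := by
    intro l
    simp only [hu]
    rcases hσv l with h | h <;> rcases hσv (l+1) with h' | h' <;> rw [h, h'] <;> norm_num
  obtain ⟨γ, g1, g2, g3⟩ := aux_coef P hP u c
    (by intro l; simp only [hu]; split_ifs <;> simp)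
    (by
      intro l; simp only [hc]; split_ifs
      · rw [abs_of_nonneg (by linarith)]
      · rw [abs_of_nonneg (le_trans hρ ((s1 l).trans (le_max_left _ _)))]
        exact max_le (s2 l) (t2 l)) q
  set G : ℝ → ℝ := fun x => ∏ l ∈ Finset.range q, (u l * x + c l) with hG
  set F : ℝ → ℝ := fun x => ∑ i ∈ Finset.range (q+1), γ i / ((i + r + 1 : ℕ) : ℝ) * x ^ (i + r + 1) with hF
  have hFd : ∀ x, HasDerivAt F (x ^ r * G x) x := by
    intro x
    have : x ^ r * G x = ∑ i ∈ Finset.range (q+1), γ i / ((i + r + 1 : ℕ) : ℝ) * (((i + r + 1 : ℕ) : ℝ) * x ^ (i + r + 1 - 1)) := by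
      simp only [hG]; rw [g1, Finset.mul_sum]
      apply Finset.sum_congr rfl
      intro i _
      have : ((i + r + 1 : ℕ) : ℝ) ≠ 0 := by positivity
      rw [← mul_assoc (γ i / _), div_mul_cancel₀ _ this]
      simp only [Nat.add_sub_cancel]; ring
    rw [this]
    apply HasDerivAt.fun_sum
    intro i _
    exact (hasDerivAt_pow _ _).const_mul _
  -- telescoping
  have htel : ∀ i, ∏ l ∈ Finset.range i, u l = σ 0 * σ i := by
    intro i
    induction i with
    | zero => simp [hσσ]
    | succ i ih =>
      rw [Finset.prod_range_succ, ih, hul]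
      linear_combination (σ 0 * σ (i+1)) * hσσ i
  have key : ∀ i, i < q + 1 → ∀ δ, 0 ≤ δ → δ ≤ P → ∀ x, min (s i) (t i) + δ ≤ x → x ≤ max (s i) (t i) - δ →
      δ ^ q ≤ σ 0 * σ i * G x := by
    intro i hi δ hδ hδP x hx1 hx2
    have e : σ 0 * σ i * G x = ∏ l ∈ Finset.range q, ((if l < i then u l else 1) * (u l * x + c l)) := by
      rw [Finset.prod_mul_distrib]
      congr 1
      rw [← htel i, ← Finset.prod_filter]
      apply Finset.prod_congr _ (fun _ _ => rfl)
      ext l; simp; omega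
    rw [e]
    have : δ ^ q = ∏ l ∈ Finset.range q, δ := by simp
    rw [this]
    apply Finset.prod_le_prod (fun _ _ => hδ)
    intro l hl
    have hx0 : 0 ≤ x := by
      have : ρ ≤ min (s i) (t i) := le_min (s1 i) (t1 i)
      linarith
    by_cases hch : σ l = σ (l+1)
    · have : u l = 1 := by simp [hu, hch]
      have h2 : c l = P := by simp [hc, hch]
      rw [this, h2]; simp; linarith
    · have h1 : u l = -1 := by simp [hu, hch]
      have h2 : c l = max (s l) (t l) := by simp [hc, hch]
      rw [h1, h2]
      by_cases hli : l < i
      · simp only [hli, if_true]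
        have : max (s l) (t l) ≤ min (s i) (t i) := by
          have hsi := hs (show l+1 ≤ i by omega)
          have hti := ht (show l+1 ≤ i by omega)
          have hsl := hs (show l ≤ l+1 by omega)
          have htl := ht (show l ≤ l+1 by omega)
          refine le_trans ?_ (min_le_min hsi hti)
          simp only [hσ] at hch
          by_cases a1 : t l ≤ s l <;> by_cases a2 : t (l+1) ≤ s (l+1) <;> simp [a1, a2] at hch
          · push Not at a2
            rw [max_eq_left a1, min_eq_left a2.le]; exact hsl
          · push Not at a1
            rw [max_eq_right a1.le, min_eq_right a2]; exact htl
        linarith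
      · simp only [hli, if_false]
        have : max (s i) (t i) ≤ max (s l) (t l) := max_le_max (hs (by omega)) (ht (by omega))
        linarith
  have hsign : ∀ i, (s i - t i) = σ i * |s i - t i| := by
    intro i; simp only [hσ]; split_ifs with h
    · rw [abs_of_nonneg (by linarith)]; ring
    · rw [abs_of_nonpos (by linarith)]; ring
  have term : ∀ i, i < q + 1 → ρ ^ r * (|s i - t i| / 4) ^ q * (|s i - t i| / 2) ≤ σ 0 * (F (s i) - F (t i)) := by
    intro i hi
    set a := min (s i) (t i) with ha
    set b := max (s i) (t i) with hb
    set d := |s i - t i| with hd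
    have hd0 : 0 ≤ d := abs_nonneg _
    have hba : b - a = d := max_sub_min_eq_abs' _ _
    have haρ : ρ ≤ a := le_min (s1 i) (t1 i)
    have hbP : b ≤ P := max_le (s2 i) (t2 i)
    have e1 : σ 0 * (F (s i) - F (t i)) = σ 0 * σ i * F b - σ 0 * σ i * F a := by
      rcases le_total (t i) (s i) with h | h
      · have h1 : σ i = 1 := by simp [hσ, h]
        rw [ha, hb, max_eq_left h, min_eq_right h, h1]; ring
      · rcases h.eq_or_lt with h' | h'
        · rw [ha, hb, h']; simp
        · have h1 : σ i = -1 := by simp [hσ, h']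
          rw [ha, hb, max_eq_right h, min_eq_left h, h1]; ring
    set H : ℝ → ℝ := fun x => σ 0 * σ i * F x with hH
    have hHd : ∀ x, HasDerivAt H (x ^ r * (σ 0 * σ i * G x)) x := by
      intro x
      have := (hFd x).const_mul (σ 0 * σ i)
      have e : x ^ r * (σ 0 * σ i * G x) = σ 0 * σ i * (x ^ r * G x) := by ring
      rw [e]; exact this
    have hHc : Continuous H := continuous_iff_continuousAt.2 (fun x => (hHd x).continuousAt)
    have mono : MonotoneOn H (Icc a b) := by
      apply monotoneOn_of_deriv_nonneg (convex_Icc a b) hHc.continuousOn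
      · intro x _; exact (hHd x).differentiableAt.differentiableWithinAt
      · intro x hx
        rw [interior_Icc] at hx
        rw [(hHd x).deriv]
        have := key i hi 0 le_rfl (by linarith) x (by linarith [hx.1]) (by linarith [hx.2])
        have h0 : (0:ℝ) ≤ 0 ^ q := by positivity
        have hx0 : 0 ≤ x := by linarith [hx.1]
        exact mul_nonneg (by positivity) (h0.trans this)
    have mvt : ρ ^ r * (d/4) ^ q * ((b - d/4) - (a + d/4)) ≤ H (b - d/4) - H (a + d/4) := by
      apply (convex_Icc (a + d/4) (b - d/4)).mul_sub_le_image_sub_of_le_deriv hHc.continuousOn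
      · intro x _; exact (hHd x).differentiableAt.differentiableWithinAt
      · intro x hx
        rw [interior_Icc] at hx
        rw [(hHd x).deriv]
        have := key i hi (d/4) (by linarith) (by linarith) x (by linarith [hx.1]) (by linarith [hx.2])
        have hx0 : ρ ≤ x := by linarith [hx.1]
        have hx1 : 0 ≤ x := by linarith
        gcongr
      · constructor <;> linarith
      · constructor <;> linarith
      · linarith
    have m1 : H a ≤ H (a + d/4) := mono ⟨le_rfl, by linarith⟩ ⟨by linarith, by linarith⟩ (by linarith)
    have m2 : H (b - d/4) ≤ H b := mono ⟨by linarith, by linarith⟩ ⟨by linarith, by linarith⟩ (by linarith)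
    rw [e1]
    have : (b - d/4) - (a + d/4) = d/2 := by linarith
    rw [this] at mvt
    change _ ≤ H b - H a
    linarith
  have hsum : ρ ^ r * (|s i - t i| / 4) ^ q * (|s i - t i| / 2) ≤ ∑ i ∈ Finset.range (q+1), σ 0 * (F (s i) - F (t i)) := by
    refine (term i hi).trans ?_
    apply Finset.single_le_sum (f := fun i => σ 0 * (F (s i) - F (t i))) _ (Finset.mem_range.2 hi)
    intro l hl
    refine le_trans ?_ (term l (Finset.mem_range.1 hl))
    positivity
  have hswap : ∑ i ∈ Finset.range (q+1), (F (s i) - F (t i)) =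
      ∑ j ∈ Finset.range (q+1), γ j / ((j + r + 1 : ℕ) : ℝ) * ∑ i ∈ Finset.range (q+1), (s i ^ (j+r+1) - t i ^ (j+r+1)) := by
    simp only [hF, ← Finset.sum_sub_distrib, Finset.mul_sum]
    rw [Finset.sum_comm]
    apply Finset.sum_congr rfl; intro j _
    apply Finset.sum_congr rfl; intro i _
    ring
  have hle : ρ ^ r * (|s i - t i| / 4) ^ q * (|s i - t i| / 2) ≤ ∑ j ∈ Finset.range (q+1), 2 ^ q * P ^ (q - j) * |∑ i ∈ Finset.range (q+1), (s i ^ (j+r+1) - t i ^ (j+r+1))| := by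
    refine hsum.trans ?_
    rw [← Finset.mul_sum, hswap]
    refine (le_abs_self _).trans ?_
    rw [abs_mul]
    have : |σ 0| = 1 := by rcases hσv 0 with h | h <;> simp [h]
    rw [this, one_mul]
    refine (Finset.abs_sum_le_sum_abs _ _).trans ?_
    apply Finset.sum_le_sum
    intro j hj
    rw [abs_mul, abs_div]
    gcongr
    refine (div_le_self (abs_nonneg _) ?_).trans (g3 j (by simp at hj; omega))
    rw [abs_of_nonneg (by positivity)]
    push_cast
    have : (0:ℝ) ≤ j := by positivity
    have : (0:ℝ) ≤ r := by positivity
    linarith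
  calc _ ≤ P ^ r * ∑ j ∈ Finset.range (q+1), 2 ^ q * P ^ (q - j) * |∑ i ∈ Finset.range (q+1), (s i ^ (j+r+1) - t i ^ (j+r+1))| := by gcongr
    _ = ∑ j ∈ Finset.range (q+1), 2 ^ q * (P ^ (q - j) * (P ^ r * |∑ i ∈ Finset.range (q+1), (s i ^ (j+r+1) - t i ^ (j+r+1))|)) := by
      rw [Finset.mul_sum]; apply Finset.sum_congr rfl; intros; ring
    _ ≤ ∑ j ∈ Finset.range (q+1), 2 ^ q * (P ^ q * T) := by
      apply Finset.sum_le_sum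
      intro j hj
      simp at hj
      have := hT (j + r) (by omega)
      have h1 : P ^ r ≤ P ^ (j+r) := pow_le_pow_right₀ hP (by omega)
      have h2 : P ^ (q-j) ≤ P ^ q := pow_le_pow_right₀ hP (by omega)
      gcongr
      refine le_trans ?_ this
      gcongr
    _ = _ := by simp; ring

lemma aux_unsorted (q r : ℕ) (P ρ T : ℝ) (hP : 1 ≤ P) (hρ : 0 ≤ ρ) (s t : Fin (q+1) → ℝ)
    (s1 : ∀ i, ρ ≤ s i) (s2 : ∀ i, s i ≤ P)
    (t1 : ∀ i, ρ ≤ t i) (t2 : ∀ i, t i ≤ P)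
    (hT : ∀ j, j < q + 1 + r → P ^ j * |∑ i, (s i ^ (j+1) - t i ^ (j+1))| ≤ T)
    (i : Fin (q+1)) :
    ∃ l, P ^ r * (ρ ^ r * (|s i - t l| / 4) ^ q * (|s i - t l| / 2)) ≤ (q + 1) * 2 ^ q * T * P ^ q := by
  have mk : ∀ f : Fin (q+1) → ℝ, Monotone (fun x : ℕ => f (Tuple.sort f ⟨min x q, by omega⟩)) := by
    intro f a b hab
    exact Tuple.monotone_sort f (by simp; omega)
  have hsum : ∀ (f : Fin (q+1) → ℝ) (j : ℕ), ∑ x ∈ Finset.range (q+1), f (Tuple.sort f ⟨min x q, by omega⟩) ^ j = ∑ i, f i ^ j := by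
    intro f j
    rw [Finset.sum_range, ← Equiv.sum_comp (Tuple.sort f) (fun i => f i ^ j)]
    apply Finset.sum_congr rfl
    intro i _
    congr 3
    ext; simp; omega
  set i' := (Tuple.sort s).symm i with hi'
  refine ⟨Tuple.sort t i', ?_⟩
  have := aux_sorted q r P ρ T hP hρ _ _ (mk s) (mk t) (fun _ => s1 _) (fun _ => s2 _) (fun _ => t1 _) (fun _ => t2 _) ?_ i' i'.2
  · have e : (⟨min (i':ℕ) q, by omega⟩ : Fin (q+1)) = i' := by ext; simp; omega
    simp only [e] at this
    rw [hi', Equiv.apply_symm_apply, ← hi'] at this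
    exact this
  · intro j hj
    have := hT j hj
    simp only [Finset.sum_sub_distrib, hsum] at this ⊢
    exact this

lemma aux_claim (k m q r : ℕ) (hm : q + 1 + r ≤ m) (hk : (k:ℝ) - 1 ≤ 3 * r) (P T : ℝ) (hP : 1 ≤ P)
    (hT0 : 0 ≤ T) (s t : Fin (q+1) → ℝ)
    (hst : (∀ i, √P ≤ s i ∧ s i ≤ P ∧ √P ≤ t i ∧ t i ≤ P) ∨
      (∀ i, √P ≤ -s i ∧ -s i ≤ P ∧ √P ≤ -t i ∧ -t i ≤ P))
    (hT : ∀ j, j < m → P ^ j * |∑ i, (s i ^ (j+1) - t i ^ (j+1))| ≤ T) (i : Fin (q+1)) :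
    ∃ l, |s i - t l| ≤ P ^ ((q + 1 - ((k:ℝ)+1)/2) / (q + 1)) * (1 + ((q+1) * 2 ^ q * 4 ^ q * 2) * T) := by
  have hP0 : 0 < P := by linarith
  have main : ∃ l, P ^ r * (√P ^ r * (|s i - t l| / 4) ^ q * (|s i - t l| / 2)) ≤ (q + 1) * 2 ^ q * T * P ^ q := by
    rcases hst with h | h
    · exact aux_unsorted q r P (√P) T hP (sqrt_nonneg _) s t (fun i => (h i).1) (fun i => (h i).2.1)
        (fun i => (h i).2.2.1) (fun i => (h i).2.2.2) (fun j hj => hT j (by omega)) i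
    · obtain ⟨l, hl⟩ := aux_unsorted q r P (√P) T hP (sqrt_nonneg _) (fun i => -s i) (fun i => -t i) (fun i => (h i).1) (fun i => (h i).2.1)
        (fun i => (h i).2.2.1) (fun i => (h i).2.2.2) (fun j hj => by
          have := hT j (by omega)
          have e : ∑ i, ((-s i) ^ (j+1) - (-t i) ^ (j+1)) = (-1) ^ (j+1) * ∑ i, (s i ^ (j+1) - t i ^ (j+1)) := by
            rw [Finset.mul_sum]; apply Finset.sum_congr rfl; intro i _
            rw [neg_pow (s i), neg_pow (t i)]; ring
          rw [e, abs_mul]; simpa using this) i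
      refine ⟨l, ?_⟩
      have e : |-s i - -t l| = |s i - t l| := by rw [← abs_neg]; congr 1; ring
      rw [e] at hl; exact hl
  obtain ⟨l, hl⟩ := main
  refine ⟨l, ?_⟩
  set d := |s i - t l| with hd
  have hd0 : 0 ≤ d := abs_nonneg _
  set lam := P ^ ((q + 1 - ((k:ℝ)+1)/2) / (q + 1)) with hlam
  have hlam0 : 0 < lam := by positivity
  set C : ℝ := ((q+1) * 2 ^ q * 4 ^ q * 2) with hC
  have hC0 : 0 ≤ C := by positivity
  have hlp : lam ^ (q+1) = P ^ (q + 1 - ((k:ℝ)+1)/2) := by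
    rw [hlam, ← rpow_natCast, ← rpow_mul hP0.le]
    congr 1; push_cast; field_simp
  have hPr : P ^ r * √P ^ r = P ^ ((3:ℝ) * r / 2) := by
    rw [sqrt_eq_rpow, ← rpow_natCast, ← rpow_natCast, ← rpow_mul hP0.le, ← rpow_add hP0]
    congr 1; ring
  have h1 : (P:ℝ) ^ q ≤ P ^ r * √P ^ r * lam ^ (q+1) := by
    rw [hPr, hlp, ← rpow_natCast, ← rpow_add hP0]
    apply rpow_le_rpow_of_exponent_le hP
    linarith
  have hpos : 0 < P ^ r * √P ^ r := by positivity
  have h2 : d ^ (q+1) ≤ C * T * lam ^ (q+1) := by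
    have e : P ^ r * (√P ^ r * (d / 4) ^ q * (d / 2)) = (P ^ r * √P ^ r) * d ^ (q+1) / (4 ^ q * 2) := by
      rw [div_pow, pow_succ]; field_simp
    rw [e, div_le_iff₀ (by positivity)] at hl
    have : (P ^ r * √P ^ r) * d ^ (q+1) ≤ (P ^ r * √P ^ r) * (C * T * lam ^ (q+1)) := by
      calc _ ≤ _ := hl
        _ = C * T * P ^ q := by rw [hC]; ring
        _ ≤ C * T * (P ^ r * √P ^ r * lam ^ (q+1)) := by gcongr
        _ = _ := by ring
    exact le_of_mul_le_mul_left this hpos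
  by_cases hdl : d ≤ lam
  · calc d ≤ lam * 1 := by linarith
      _ ≤ _ := by gcongr; linarith [mul_nonneg hC0 hT0]
  · push Not at hdl
    have : d * lam ^ q ≤ (C * T * lam) * lam ^ q := by
      calc _ ≤ d * d ^ q := by gcongr
        _ = d ^ (q+1) := by ring
        _ ≤ _ := h2
        _ = _ := by ring
    have := le_of_mul_le_mul_right this (by positivity)
    calc d ≤ _ := this
      _ ≤ lam * (1 + C * T) := by nlinarith

noncomputable def LL (μ : Measure ℝ) : ℝ := ⨆ a : ℝ, (μ (Set.Ioc a (a + 1))).toReal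

lemma LL_le (μ : Measure ℝ) [IsProbabilityMeasure μ] (a : ℝ) : μ.real (Ioc a (a+1)) ≤ LL μ := by
  apply le_ciSup (f := fun a : ℝ => (μ (Set.Ioc a (a + 1))).toReal)
  refine ⟨1, ?_⟩
  rintro _ ⟨b, rfl⟩
  exact measureReal_le_one (μ := μ)

lemma LL_nonneg (μ : Measure ℝ) : 0 ≤ LL μ := Real.iSup_nonneg (fun _ => ENNReal.toReal_nonneg)

lemma mass_le (μ : Measure ℝ) [IsProbabilityMeasure μ] (a w : ℝ) (hw : 0 ≤ w) :
    μ.real (Ioc a (a+w)) ≤ (w + 1) * LL μ := by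
  have h : ∀ N : ℕ, μ.real (Ioc a (a+N)) ≤ N * LL μ := by
    intro N
    induction N with
    | zero => simp
    | succ N ih =>
      have : Ioc a (a + ((N+1 : ℕ):ℝ)) ⊆ Ioc a (a+N) ∪ Ioc (a+N) (a+N+1) := by
        rw [Ioc_union_Ioc_eq_Ioc]
        · push_cast; rw [add_assoc]
        · simp
        · simp
      calc _ ≤ _ := measureReal_mono this
        _ ≤ _ := measureReal_union_le _ _
        _ ≤ N * LL μ + LL μ := add_le_add ih (LL_le μ _)
        _ = _ := by push_cast; ring
  calc _ ≤ μ.real (Ioc a (a + ⌈w⌉₊)) := by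
        refine measureReal_mono ?_ (measure_ne_top _ _)
        apply Ioc_subset_Ioc_right
        linarith [Nat.le_ceil w]
    _ ≤ _ := h _
    _ ≤ _ := by
      gcongr
      · exact LL_nonneg μ
      · exact (Nat.ceil_lt_add_one hw).le

lemma summ_psi : Summable (fun v : ℤ => (1:ℝ) / (1 + (v:ℝ)^2)) := by
  have h1 : Summable (fun v : ℤ => (1:ℝ) / ((v:ℝ)^2) + if v = 0 then 1 else 0) := by
    apply Summable.add
    · exact Real.summable_one_div_int_pow.2 (by norm_num)
    · apply summable_of_ne_finset_zero (s := {0})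
      intro b hb; simp at hb; simp [hb]
  refine Summable.of_nonneg_of_le (fun v => by positivity) ?_ h1
  intro v
  by_cases hv : v = 0
  · simp [hv]
  · simp only [hv, if_false, add_zero]
    have : (0:ℝ) < (v:ℝ)^2 := by positivity
    gcongr; linarith

noncomputable def Cpsi : ℝ := 6 * ∑' v : ℤ, (1:ℝ) / (1 + (v:ℝ)^2)

lemma psi_meas (b lam : ℝ) : Continuous (fun s : ℝ => 1 / (1 + ((s - b)/lam)^2)) := by
  apply Continuous.div (by fun_prop) (by fun_prop)
  intro x; positivity

lemma psi_int (μ : Measure ℝ) [IsFiniteMeasure μ] (b lam : ℝ) : Integrable (fun s : ℝ => 1 / (1 + ((s - b)/lam)^2)) μ := by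
  apply Integrable.mono' (integrable_const (1:ℝ)) (psi_meas b lam).aestronglyMeasurable
  filter_upwards with s
  rw [Real.norm_of_nonneg (by positivity), div_le_one (by positivity)]
  linarith [sq_nonneg ((s-b)/lam)]

lemma psi_le (μ : Measure ℝ) [IsProbabilityMeasure μ] (b lam : ℝ) (hl : 1 ≤ lam) :
    ∫ s, 1 / (1 + ((s - b)/lam)^2) ∂μ ≤ Cpsi * lam * LL μ := by
  have hl0 : 0 < lam := by linarith
  have hU := iUnion_Ioc_add_zsmul hl0 b
  have hD := pairwise_disjoint_Ioc_add_zsmul b lam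
  have hs := hasSum_integral_iUnion (μ := μ) (f := fun s : ℝ => 1 / (1 + ((s - b)/lam)^2))
    (fun i : ℤ => measurableSet_Ioc) hD (psi_int μ b lam).integrableOn
  rw [hU, setIntegral_univ] at hs
  have h2 : HasSum (fun v : ℤ => (1:ℝ) / (1 + (v:ℝ)^2) * (6 * lam * LL μ)) (Cpsi * lam * LL μ) := by
    have := summ_psi.hasSum.mul_right (6 * lam * LL μ)
    have e : Cpsi * lam * LL μ = (∑' v : ℤ, (1:ℝ) / (1 + (v:ℝ)^2)) * (6 * lam * LL μ) := by
      unfold Cpsi; ring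
    rw [e]; exact this
  refine hasSum_le ?_ hs h2
  intro v
  have hb : ∀ x ∈ Ioc (b + v • lam) (b + (v+1) • lam), ‖1 / (1 + ((x - b)/lam)^2)‖ ≤ 3 / (1 + (v:ℝ)^2) := by
    intro x hx
    simp only [zsmul_eq_mul, mem_Ioc] at hx
    push_cast at hx
    rw [Real.norm_of_nonneg (by positivity), div_le_div_iff₀ (by positivity) (by positivity)]
    have h1 : (v:ℝ) ≤ (x-b)/lam := by rw [le_div_iff₀ hl0]; linarith
    have h2 : (x-b)/lam ≤ v + 1 := by rw [div_le_iff₀ hl0]; linarith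
    nlinarith [sq_nonneg ((x-b)/lam), sq_nonneg ((x-b)/lam + ((x-b)/lam - v))]
  have h3 := norm_setIntegral_le_of_norm_le_const (μ := μ) (measure_lt_top μ _) hb
  refine (le_abs_self _).trans (h3.trans ?_)
  have h4 : μ.real (Ioc (b + v • lam) (b + (v+1) • lam)) ≤ 2 * lam * LL μ := by
    have := mass_le μ (b + v • lam) lam hl0.le
    have e : b + v • lam + lam = b + (v+1) • lam := by rw [add_smul, one_smul]; ring
    rw [e] at this
    refine this.trans ?_
    have := LL_nonneg μ
    gcongr; linarith
  calc _ ≤ 3 / (1 + (v:ℝ)^2) * (2 * lam * LL μ) := by gcongr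
    _ = _ := by ring

noncomputable def GG {m : ℕ} (w : Fin m → ℝ) (α : Fin m → ℝ) : ℝ := ∏ j, Real.exp (-(π/(w j)^2) * (α j)^2)

lemma GG_int {m : ℕ} (w : Fin m → ℝ) (hw : ∀ j, 0 < w j) : Integrable (GG w) := by
  unfold GG
  apply Integrable.fintype_prod (f := fun j x => Real.exp (-(π/(w j)^2) * x^2))
  intro j
  exact integrable_exp_neg_mul_sq (by have := hw j; positivity)

lemma GG_nonneg {m : ℕ} (w α : Fin m → ℝ) : 0 ≤ GG w α := Finset.prod_nonneg (fun _ _ => (Real.exp_pos _).le)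

noncomputable def ee (x : ℝ) : ℂ := Complex.exp (2 * (Real.pi : ℂ) * Complex.I * (x : ℂ))

lemma ee_norm (x : ℝ) : ‖ee x‖ = 1 := by
  unfold ee
  rw [show 2 * (Real.pi : ℂ) * Complex.I * (x : ℂ) = ((2 * π * x : ℝ) : ℂ) * Complex.I by push_cast; ring]
  exact Complex.norm_exp_ofReal_mul_I _

lemma ee_cont : Continuous ee := by unfold ee; fun_prop

lemma ee_add (x y : ℝ) : ee (x + y) = ee x * ee y := by
  unfold ee; rw [← Complex.exp_add]; congr 1; push_cast; ring

lemma ee_neg (x : ℝ) : ee (-x) = (starRingEnd ℂ) (ee x) := by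
  unfold ee; rw [← Complex.exp_conj]; congr 1; simp [Complex.conj_ofNat]

lemma ee_sum {ι : Type*} (s : Finset ι) (f : ι → ℝ) : ee (∑ i ∈ s, f i) = ∏ i ∈ s, ee (f i) := by
  unfold ee; rw [← Complex.exp_sum]; congr 1; push_cast; rw [Finset.mul_sum]

lemma gauss_one {m : ℕ} (w : Fin m → ℝ) (hw : ∀ j, 0 < w j) (D : Fin m → ℝ) :
    ∫ α : Fin m → ℝ, (GG w α : ℂ) * ee (∑ j, α j * D j) = ((∏ j, w j * Real.exp (-π * (w j * D j)^2) : ℝ) : ℂ) := by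
  have h := GaussianFourier.integral_cexp_neg_sum_mul_add (ι := Fin m) (b := fun j => ((π/(w j)^2 : ℝ) : ℂ))
    (fun j => by have := hw j; rw [Complex.ofReal_re]; positivity) (fun j => 2 * (π:ℂ) * Complex.I * (D j : ℂ))
  have e : ∀ α : Fin m → ℝ, (GG w α : ℂ) * ee (∑ j, α j * D j) = Complex.exp (-∑ j, ((π/(w j)^2 : ℝ) : ℂ) * (α j : ℂ)^2 + ∑ j, 2 * (π:ℂ) * Complex.I * (D j : ℂ) * (α j : ℂ)) := by
    intro α
    unfold GG ee
    rw [← Real.exp_sum, Complex.ofReal_exp, ← Complex.exp_add]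
    congr 1
    push_cast
    rw [Finset.mul_sum, ← Finset.sum_neg_distrib]
    congr 1
    · apply Finset.sum_congr rfl; intros; ring
    · apply Finset.sum_congr rfl; intros; ring
  simp_rw [e]
  rw [h]
  push_cast
  apply Finset.prod_congr rfl
  intro j _
  have hj := hw j
  have hp := Real.pi_pos
  congr 1
  · rw [show (π:ℂ) / ((π:ℂ)/(w j:ℂ)^2) = ((w j)^2 : ℝ) by
      push_cast
      have : (π:ℂ) ≠ 0 := by exact_mod_cast hp.ne'
      have : (w j:ℂ) ≠ 0 := by exact_mod_cast hj.ne'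
      field_simp]
    rw [show (1/2:ℂ) = ((1/2:ℝ):ℂ) by push_cast; rfl, ← Complex.ofReal_cpow (by positivity), ← Real.sqrt_eq_rpow, Real.sqrt_sq hj.le]
  · congr 1
    have : (π:ℂ) ≠ 0 := by exact_mod_cast hp.ne'
    have : (w j:ℂ) ≠ 0 := by exact_mod_cast hj.ne'
    field_simp
    rw [Complex.I_sq]; ring

lemma gauss_swap {Z : Type*} [MeasurableSpace Z] (ρ : Measure Z) [IsFiniteMeasure ρ] {m : ℕ} (w : Fin m → ℝ) (hw : ∀ j, 0 < w j)
    (D : Fin m → Z → ℝ) (hD : ∀ j, Measurable (D j)) :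
    ∫ α : Fin m → ℝ, (GG w α : ℂ) * ∫ z, ee (∑ j, α j * D j z) ∂ρ
     = ((∫ z, ∏ j, w j * Real.exp (-π * (w j * D j z)^2) ∂ρ : ℝ) : ℂ) := by
  rw [← integral_complex_ofReal]
  simp_rw [← gauss_one w hw, ← integral_const_mul]
  rw [integral_integral_swap]
  have h1 : Integrable (fun p : (Fin m → ℝ) × Z => (GG w p.1 : ℂ)) (volume.prod ρ) :=
    (Integrable.comp_fst (GG_int w hw) ρ).ofReal
  refine h1.mono ?_ ?_
  · refine h1.aestronglyMeasurable.mul ?_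
    apply Measurable.aestronglyMeasurable
    apply ee_cont.measurable.comp
    apply Finset.measurable_sum
    intro j _
    exact ((measurable_pi_apply j).comp measurable_fst).mul ((hD j).comp measurable_snd)
  · refine Filter.Eventually.of_forall fun p => ?_
    simp [Function.uncurry, ee_norm]

lemma norm_pow_eq (ν : Measure ℝ) [IsFiniteMeasure ν] {m n : ℕ} (φ : Fin m → ℝ → ℝ) (hφ : ∀ j, Measurable (φ j)) (α : Fin m → ℝ) :
    ((‖∫ s, ee (∑ j, α j * φ j s) ∂ν‖^(2*n) : ℝ) : ℂ) =
    ∫ z, ee (∑ j, α j * ∑ i, (φ j (z.2 i) - φ j (z.1 i))) ∂((Measure.pi (fun _ : Fin n => ν)).prod (Measure.pi (fun _ : Fin n => ν))) := by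
  have e : ∀ z : (Fin n → ℝ) × (Fin n → ℝ), ee (∑ j, α j * ∑ i, (φ j (z.2 i) - φ j (z.1 i))) =
     (∏ i, (starRingEnd ℂ) (ee (∑ j, α j * φ j (z.1 i)))) * (∏ i, ee (∑ j, α j * φ j (z.2 i))) := by
    intro z
    simp_rw [← ee_neg]
    rw [← ee_sum, ← ee_sum, ← ee_add]
    congr 1
    simp_rw [Finset.mul_sum]
    rw [Finset.sum_comm, ← Finset.sum_add_distrib]
    apply Finset.sum_congr rfl
    intro i _
    rw [← Finset.sum_neg_distrib, ← Finset.sum_add_distrib]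
    apply Finset.sum_congr rfl
    intros; ring
  simp_rw [e]
  rw [integral_prod_mul (f := fun x : Fin n → ℝ => ∏ i, (starRingEnd ℂ) (ee (∑ j, α j * φ j (x i)))) (g := fun x : Fin n → ℝ => ∏ i, ee (∑ j, α j * φ j (x i)))]
  rw [integral_fintype_prod_eq_pow (ι := Fin n) (fun x => ee (∑ j, α j * φ j x)),
    integral_fintype_prod_eq_pow (ι := Fin n) (fun x => (starRingEnd ℂ) (ee (∑ j, α j * φ j x)))]
  rw [integral_conj, ← mul_pow, Fintype.card_fin, pow_mul, Complex.conj_mul']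
  push_cast
  rfl

lemma gauss_bound (ν : Measure ℝ) [IsFiniteMeasure ν] {m n : ℕ} (w : Fin m → ℝ) (hw : ∀ j, 0 < w j) (φ : Fin m → ℝ → ℝ) (hφ : ∀ j, Measurable (φ j)) :
    ∫ α in Set.univ.pi (fun j : Fin m => Set.Icc (-(w j)) (w j)), ‖∫ s, ee (∑ j, α j * φ j s) ∂ν‖^(2*n)
    ≤ Real.exp (π*m) * ((∏ j, w j) * ∫ z, Real.exp (-π * ∑ j, (w j * ∑ i, (φ j (z.2 i) - φ j (z.1 i)))^2) ∂((Measure.pi (fun _ : Fin n => ν)).prod (Measure.pi (fun _ : Fin n => ν)))) := by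
  have key : ∫ α : Fin m → ℝ, GG w α * ‖∫ s, ee (∑ j, α j * φ j s) ∂ν‖^(2*n) =
      (∏ j, w j) * ∫ z, Real.exp (-π * ∑ j, (w j * ∑ i, (φ j (z.2 i) - φ j (z.1 i)))^2) ∂((Measure.pi (fun _ : Fin n => ν)).prod (Measure.pi (fun _ : Fin n => ν))) := by
    have h := gauss_swap ((Measure.pi (fun _ : Fin n => ν)).prod (Measure.pi (fun _ : Fin n => ν))) w hw
      (fun j z => ∑ i, (φ j (z.2 i) - φ j (z.1 i))) (fun j => by
        apply Finset.measurable_sum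
        intro i _
        exact ((hφ j).comp ((measurable_pi_apply i).comp measurable_snd)).sub ((hφ j).comp ((measurable_pi_apply i).comp measurable_fst)))
    simp_rw [← norm_pow_eq ν φ hφ, ← Complex.ofReal_mul] at h
    rw [integral_complex_ofReal] at h
    have h' := Complex.ofReal_injective h
    rw [h', ← integral_const_mul]
    congr 1
    ext z
    rw [Finset.prod_mul_distrib, ← Real.exp_sum, Finset.mul_sum]
  have hc : Continuous (fun α : Fin m → ℝ => ‖∫ s, ee (∑ j, α j * φ j s) ∂ν‖^(2*n)) := by
    apply Continuous.pow
    apply Continuous.norm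
    apply continuous_of_dominated (bound := fun _ => 1)
    · intro α
      apply Measurable.aestronglyMeasurable
      apply ee_cont.measurable.comp
      apply Finset.measurable_sum
      intro j _
      exact (hφ j).const_mul _
    · intro α
      exact Filter.Eventually.of_forall fun s => (ee_norm _).le
    · exact integrable_const _
    · refine Filter.Eventually.of_forall fun s => ?_
      apply ee_cont.comp
      fun_prop
  have hb : ∀ α : Fin m → ℝ, ‖∫ s, ee (∑ j, α j * φ j s) ∂ν‖^(2*n) ≤ (ν.real univ)^(2*n) := by
    intro α
    apply pow_le_pow_left₀ (norm_nonneg _)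
    refine (norm_integral_le_of_norm_le_const (C := 1) (Filter.Eventually.of_forall fun s => (ee_norm _).le)).trans ?_
    simp
  have hG : Integrable (fun α : Fin m → ℝ => GG w α * ‖∫ s, ee (∑ j, α j * φ j s) ∂ν‖^(2*n)) := by
    refine Integrable.mono' ((GG_int w hw).mul_const ((ν.real univ)^(2*n))) ((GG_int w hw).aestronglyMeasurable.mul hc.aestronglyMeasurable) ?_
    refine Filter.Eventually.of_forall fun α => ?_
    rw [Real.norm_of_nonneg (mul_nonneg (GG_nonneg _ _) (by positivity))]
    exact mul_le_mul_of_nonneg_left (hb α) (GG_nonneg _ _)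
  rw [← key, ← integral_const_mul]
  have hbox : IsCompact (Set.univ.pi (fun j : Fin m => Set.Icc (-(w j)) (w j))) := isCompact_univ_pi fun _ => isCompact_Icc
  refine (setIntegral_mono_on (hc.continuousOn.integrableOn_compact hbox) (hG.const_mul (Real.exp (π*m))).integrableOn hbox.measurableSet ?_).trans
    (setIntegral_le_integral (hG.const_mul _) (Filter.Eventually.of_forall fun α => ?_))
  · intro α hα
    rw [← mul_assoc]
    refine le_mul_of_one_le_left (by positivity) ?_
    unfold GG
    rw [← Real.exp_sum, ← Real.exp_add, Real.one_le_exp_iff]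
    have : ∑ j : Fin m, (-π) ≤ ∑ j, -(π/(w j)^2) * (α j)^2 := by
      apply Finset.sum_le_sum
      intro j _
      have h1 := hα j (mem_univ j)
      have h2 : (α j)^2 ≤ (w j)^2 := by apply sq_le_sq'; exact h1.1; exact h1.2
      have h3 := hw j
      have : π/(w j)^2 * (α j)^2 ≤ π/(w j)^2 * (w j)^2 := mul_le_mul_of_nonneg_left h2 (by positivity)
      have h4 : π/(w j)^2 * (w j)^2 = π := by field_simp
      linarith
    simp at this ⊢
    linarith
  · exact mul_nonneg (by positivity) (mul_nonneg (GG_nonneg _ _) (by positivity))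

noncomputable def Cq (q : ℕ) : ℝ := ((q:ℝ)+1)*2^q*4^q*2
noncomputable def KK (q : ℕ) : ℝ := ((3+2*(Cq q)^2)*(q+1))^(q+1)
noncomputable def lam (k q : ℕ) (P : ℝ) : ℝ := P^(((q:ℝ)+1-((k:ℝ)+1)/2)/(q+1))

lemma ptw (k m q r : ℕ) (hm : q+1+r ≤ m) (hk : (k:ℝ)-1 ≤ 3*r) (P : ℝ) (hP : 1≤P) (s t : Fin (q+1) → ℝ)
    (hst : (∀ i, √P ≤ s i ∧ s i ≤ P ∧ √P ≤ t i ∧ t i ≤ P) ∨ (∀ i, √P ≤ -s i ∧ -s i ≤ P ∧ √P ≤ -t i ∧ -t i ≤ P)) :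
    Real.exp (-π * ∑ j : Fin m, (P^(j:ℕ) * ∑ i, (s i^((j:ℕ)+1) - t i^((j:ℕ)+1)))^2)
     ≤ KK q * ∏ i, ∑ l, 1/(1+((s i - t l)/lam k q P)^2) := by
  set T2 := ∑ j : Fin m, (P^(j:ℕ) * ∑ i, (s i^((j:ℕ)+1) - t i^((j:ℕ)+1)))^2 with hT2
  have hT20 : 0 ≤ T2 := Finset.sum_nonneg fun _ _ => sq_nonneg _
  have hTT : ∀ j, j < m → P^j * |∑ i, (s i^(j+1) - t i^(j+1))| ≤ √T2 := by
    intro j hj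
    apply Real.le_sqrt_of_sq_le
    have := Finset.single_le_sum (f := fun j : Fin m => (P^(j:ℕ) * ∑ i, (s i^((j:ℕ)+1) - t i^((j:ℕ)+1)))^2) (fun _ _ => sq_nonneg _) (Finset.mem_univ (⟨j, hj⟩ : Fin m))
    rw [mul_pow, sq_abs, ← mul_pow]
    exact this
  have hcl := aux_claim k m q r hm hk P (√T2) hP (Real.sqrt_nonneg _) s t hst hTT
  have hlam : 0 < lam k q P := by unfold lam; positivity
  have hC : 0 ≤ Cq q := by unfold Cq; positivity
  have hsq := Real.sq_sqrt hT20
  have hone : ∀ i, ((3+2*(Cq q)^2)*(q+1) * Real.exp (T2/(q+1)))⁻¹ ≤ ∑ l, 1/(1+((s i - t l)/lam k q P)^2) := by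
    intro i
    obtain ⟨l, hl⟩ := hcl i
    refine le_trans ?_ (Finset.single_le_sum (f := fun l => 1/(1+((s i - t l)/lam k q P)^2)) (fun _ _ => by positivity) (Finset.mem_univ l))
    rw [one_div]
    apply inv_anti₀ (by positivity)
    have h1 : |(s i - t l)/lam k q P| ≤ 1 + Cq q * √T2 := by
      rw [abs_div, abs_of_pos hlam, div_le_iff₀ hlam, mul_comm]
      exact hl
    have h2 : ((s i - t l)/lam k q P)^2 ≤ (1 + Cq q * √T2)^2 := by
      rw [← sq_abs]; exact pow_le_pow_left₀ (abs_nonneg _) h1 2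
    have h3 : 1 + T2 ≤ (q+1) * Real.exp (T2/(q+1)) := by
      have := Real.add_one_le_exp (T2/((q:ℝ)+1))
      have h4 : ((q:ℝ)+1) * (T2/(q+1) + 1) ≤ (q+1) * Real.exp (T2/(q+1)) := mul_le_mul_of_nonneg_left this (by positivity)
      have h5 : ((q:ℝ)+1) * (T2/(q+1) + 1) = T2 + (q+1) := by field_simp
      have : (0:ℝ) ≤ q := by positivity
      linarith
    have h6 : 1 + (1 + Cq q * √T2)^2 ≤ (3+2*(Cq q)^2)*(1+T2) := by
      nlinarith [sq_nonneg (1 - Cq q * √T2), sq_nonneg (Cq q)]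
    calc _ ≤ (3+2*(Cq q)^2)*(1+T2) := by linarith
      _ ≤ _ := by rw [mul_assoc]; exact mul_le_mul_of_nonneg_left h3 (by positivity)
  have hprod : (((3+2*(Cq q)^2)*(q+1) * Real.exp (T2/(q+1)))⁻¹)^(q+1) ≤ ∏ i, ∑ l, 1/(1+((s i - t l)/lam k q P)^2) := by
    have := Finset.prod_le_prod (s := Finset.univ) (f := fun _ : Fin (q+1) => ((3+2*(Cq q)^2)*(q+1) * Real.exp (T2/(q+1)))⁻¹) (fun _ _ => by positivity) (fun i _ => hone i)
    simpa using this
  have hK : 0 < KK q := by unfold KK; positivity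
  have hee : (Real.exp (T2/(q+1)))^(q+1) = Real.exp T2 := by
    rw [← Real.exp_nat_mul]; congr 1; push_cast; field_simp
  rw [inv_pow, mul_pow, hee] at hprod
  have : KK q * ((KK q) * Real.exp T2)⁻¹ ≤ KK q * ∏ i, ∑ l, 1/(1+((s i - t l)/lam k q P)^2) := mul_le_mul_of_nonneg_left hprod hK.le
  refine le_trans ?_ this
  rw [mul_inv, ← mul_assoc, mul_inv_cancel₀ hK.ne', one_mul, ← Real.exp_neg, Real.exp_le_exp]
  nlinarith [Real.pi_gt_three]

lemma ae_mem_pi (μ : Measure ℝ) [IsFiniteMeasure μ] (A : Set ℝ) (hA : MeasurableSet A) (n : ℕ) :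
    ∀ᵐ s ∂(Measure.pi (fun _ : Fin n => μ.restrict A)), ∀ i, s i ∈ A := by
  rw [ae_all_iff]
  intro i
  exact (Measure.quasiMeasurePreserving_eval (fun _ : Fin n => μ.restrict A) i).ae (ae_restrict_mem hA)

lemma lam_ge (k q : ℕ) (hq : q = k/2) (P : ℝ) (hP : 1 ≤ P) : 1 ≤ lam k q P := by
  unfold lam
  apply Real.one_le_rpow hP
  apply div_nonneg _ (by positivity)
  have : k + 1 ≤ 2*(q+1) := by omega
  have : ((k+1:ℕ):ℝ) ≤ ((2*(q+1):ℕ):ℝ) := by exact_mod_cast this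
  push_cast at this
  linarith

lemma main_A (k m q r : ℕ) (hq : q = k/2) (hm : q+1+r ≤ m) (hk : (k:ℝ)-1 ≤ 3*r) (P : ℝ) (hP : 1≤P)
    (μ : Measure ℝ) [IsProbabilityMeasure μ] (A : Set ℝ) (hAm : MeasurableSet A)
    (hA : (∀ x ∈ A, √P ≤ x ∧ x ≤ P) ∨ (∀ x ∈ A, √P ≤ -x ∧ -x ≤ P)) :
    ∫ α in Set.univ.pi (fun j : Fin m => Set.Icc (-(P^(j:ℕ))) (P^(j:ℕ))), ‖∫ s in A, ee (∑ j : Fin m, α j * s^((j:ℕ)+1)) ∂μ‖^(2*(q+1))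
    ≤ Real.exp (π*m) * ((∏ j : Fin m, P^(j:ℕ)) * (KK q * ((((q:ℝ)+1)*(Cpsi*lam k q P*LL μ))^(q+1) * (μ.real A)^(q+1)))) := by
  have hl := lam_ge k q hq P hP
  refine (gauss_bound (μ.restrict A) (n := q+1) (fun j : Fin m => P^(j:ℕ)) (fun j => by positivity) (fun j s => s^((j:ℕ)+1)) (fun j => by fun_prop)).trans ?_
  apply mul_le_mul_of_nonneg_left _ (by positivity)
  apply mul_le_mul_of_nonneg_left _ (by positivity)
  set N := Measure.pi (fun _ : Fin (q+1) => μ.restrict A) with hN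
  have hcont : Continuous (fun z : (Fin (q+1) → ℝ) × (Fin (q+1) → ℝ) => ∏ i, ∑ l, 1/(1+((z.2 i - z.1 l)/lam k q P)^2)) := by
    apply continuous_finsetProd
    intro i _
    apply continuous_finsetSum
    intro l _
    refine Continuous.div continuous_const (by fun_prop) (fun z => by positivity)
  have hbd : ∀ z : (Fin (q+1) → ℝ) × (Fin (q+1) → ℝ), ∏ i, ∑ l, 1/(1+((z.2 i - z.1 l)/lam k q P)^2) ≤ ((q:ℝ)+1)^(q+1) := by
    intro z
    have : ∀ i, ∑ l, 1/(1+((z.2 i - z.1 l)/lam k q P)^2) ≤ (q:ℝ)+1 := by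
      intro i
      have : ∑ l, 1/(1+((z.2 i - z.1 l)/lam k q P)^2) ≤ ∑ l : Fin (q+1), (1:ℝ) := by
        apply Finset.sum_le_sum
        intro l _
        rw [div_le_one (by positivity)]
        have := sq_nonneg ((z.2 i - z.1 l)/lam k q P)
        linarith
      simpa using this
    have := Finset.prod_le_prod (s := Finset.univ) (f := fun i : Fin (q+1) => ∑ l, 1/(1+((z.2 i - z.1 l)/lam k q P)^2)) (fun _ _ => by positivity) (fun i _ => this i)
    simpa using this
  have hint : Integrable (fun z : (Fin (q+1) → ℝ) × (Fin (q+1) → ℝ) => ∏ i, ∑ l, 1/(1+((z.2 i - z.1 l)/lam k q P)^2)) (N.prod N) := by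
    refine Integrable.mono' (integrable_const (((q:ℝ)+1)^(q+1))) hcont.aestronglyMeasurable (Filter.Eventually.of_forall fun z => ?_)
    rw [Real.norm_of_nonneg (by positivity)]
    exact hbd z
  have hae := ae_mem_pi μ A hAm (q+1)
  have h1 : ∀ᵐ z ∂(N.prod N), ∀ i, z.1 i ∈ A := Measure.quasiMeasurePreserving_fst.ae hae
  have h2 : ∀ᵐ z ∂(N.prod N), ∀ i, z.2 i ∈ A := Measure.quasiMeasurePreserving_snd.ae hae
  have hKK : 0 ≤ KK q := by unfold KK; positivity
  calc _ ≤ ∫ z, KK q * ∏ i, ∑ l, 1/(1+((z.2 i - z.1 l)/lam k q P)^2) ∂(N.prod N) := by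
        apply integral_mono_of_nonneg
        · exact Filter.Eventually.of_forall fun z => (Real.exp_pos _).le
        · exact hint.const_mul _
        · filter_upwards [h1, h2] with z hz1 hz2
          apply ptw k m q r hm hk P hP z.2 z.1
          rcases hA with hA | hA
          · left; intro i; exact ⟨(hA _ (hz2 i)).1, (hA _ (hz2 i)).2, (hA _ (hz1 i)).1, (hA _ (hz1 i)).2⟩
          · right; intro i; exact ⟨(hA _ (hz2 i)).1, (hA _ (hz2 i)).2, (hA _ (hz1 i)).1, (hA _ (hz1 i)).2⟩
    _ = KK q * ∫ t, ∫ s, ∏ i, ∑ l, 1/(1+((s i - t l)/lam k q P)^2) ∂N ∂N := by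
        rw [integral_const_mul, integral_prod _ hint]
    _ ≤ _ := by
        apply mul_le_mul_of_nonneg_left _ hKK
        have hin : ∀ t : Fin (q+1) → ℝ, ∫ s, ∏ i, ∑ l, 1/(1+((s i - t l)/lam k q P)^2) ∂N ≤ (((q:ℝ)+1)*(Cpsi*lam k q P*LL μ))^(q+1) := by
          intro t
          rw [hN, integral_fintype_prod_eq_pow (ι := Fin (q+1)) (fun x => ∑ l, 1/(1+((x - t l)/lam k q P)^2)), Fintype.card_fin]
          apply pow_le_pow_left₀ (integral_nonneg fun x => by positivity)
          rw [integral_finsetSum _ (fun l _ => psi_int _ _ _)]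
          have : ∑ l, ∫ x in A, 1/(1+((x - t l)/lam k q P)^2) ∂μ ≤ ∑ l : Fin (q+1), Cpsi*lam k q P*LL μ := by
            apply Finset.sum_le_sum
            intro l _
            exact (setIntegral_le_integral (psi_int _ _ _) (Filter.Eventually.of_forall fun x => by positivity)).trans (psi_le μ _ _ hl)
          simpa using this
        have : ∫ t, ∫ s, ∏ i, ∑ l, 1/(1+((s i - t l)/lam k q P)^2) ∂N ∂N ≤ ∫ t, (((q:ℝ)+1)*(Cpsi*lam k q P*LL μ))^(q+1) ∂N :=
          integral_mono hint.integral_prod_left (integrable_const _) hin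
        refine this.trans (le_of_eq ?_)
        rw [integral_const, smul_eq_mul, mul_comm]
        congr 1
        rw [hN, Measure.real, Measure.pi_univ]
        simp [Measure.real]

lemma pow3 (a b c : ℝ) (ha : 0 ≤ a) (hb : 0 ≤ b) (hc : 0 ≤ c) (p : ℕ) : (a+b+c)^p ≤ 3^p*(a^p+b^p+c^p) := by
  have h : ∀ x, 0 ≤ x → a + b + c ≤ 3*x → x^p ≤ a^p+b^p+c^p → (a+b+c)^p ≤ 3^p*(a^p+b^p+c^p) := by
    intro x hx h1 h2
    calc _ ≤ (3*x)^p := pow_le_pow_left₀ (by positivity) h1 p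
      _ = 3^p*x^p := mul_pow _ _ _
      _ ≤ _ := mul_le_mul_of_nonneg_left h2 (by positivity)
  have h1 : 0 ≤ a^p := by positivity
  have h2 : 0 ≤ b^p := by positivity
  have h3 : 0 ≤ c^p := by positivity
  rcases le_total a b with h4 | h4 <;> rcases le_total b c with h5 | h5 <;> rcases le_total a c with h6 | h6
  all_goals first
    | exact h a ha (by linarith) (by linarith)
    | exact h b hb (by linarith) (by linarith)
    | exact h c hc (by linarith) (by linarith)

noncomputable def FF (m : ℕ) (μ : Measure ℝ) (A : Set ℝ) (α : Fin m → ℝ) : ℂ := ∫ s in A, ee (∑ j : Fin m, α j * s^((j:ℕ)+1)) ∂μ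

lemma FF_cont (m : ℕ) (μ : Measure ℝ) [IsProbabilityMeasure μ] (A : Set ℝ) : Continuous (FF m μ A) := by
  unfold FF
  apply continuous_of_dominated (bound := fun _ => 1)
  · intro α
    exact (ee_cont.comp (by fun_prop : Continuous fun s : ℝ => ∑ j : Fin m, α j * s^((j:ℕ)+1))).aestronglyMeasurable
  · intro α
    exact Filter.Eventually.of_forall fun s => (ee_norm _).le
  · exact integrable_const _
  · refine Filter.Eventually.of_forall fun s => ?_
    apply ee_cont.comp
    fun_prop

lemma FF_le (m : ℕ) (μ : Measure ℝ) [IsProbabilityMeasure μ] (A : Set ℝ) (α : Fin m → ℝ) : ‖FF m μ A α‖ ≤ μ.real A := by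
  refine (norm_integral_le_of_norm_le_const (C := 1) (Filter.Eventually.of_forall fun s => (ee_norm _).le)).trans ?_
  simp

noncomputable def BB (m : ℕ) (P : ℝ) : Set (Fin m → ℝ) := Set.univ.pi (fun j : Fin m => Set.Icc (-(P^(j:ℕ))) (P^(j:ℕ)))

lemma BB_compact (m : ℕ) (P : ℝ) : IsCompact (BB m P) := isCompact_univ_pi fun _ => isCompact_Icc

lemma BB_int (m : ℕ) (μ : Measure ℝ) [IsProbabilityMeasure μ] (A : Set ℝ) (P : ℝ) (p : ℕ) :
    IntegrableOn (fun α => ‖FF m μ A α‖^p) (BB m P) :=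
  (((FF_cont m μ A).norm.pow p).continuousOn).integrableOn_compact (BB_compact m P)

lemma partA (k m q r : ℕ) (hk1 : 1 ≤ k) (hq : q = k/2) (hm : q+1+r ≤ m) (hk : (k:ℝ)-1 ≤ 3*r) (P : ℝ) (hP : 1≤P)
    (μ : Measure ℝ) [IsProbabilityMeasure μ] (A : Set ℝ) (hAm : MeasurableSet A) (hAs : A ⊆ Ioc (-P) P)
    (hA : (∀ x ∈ A, √P ≤ x ∧ x ≤ P) ∨ (∀ x ∈ A, √P ≤ -x ∧ -x ≤ P)) :
    ∫ α in BB m P, ‖FF m μ A α‖^(2*k) ≤ (Real.exp (π*m) * KK q * ((q+1)*Cpsi)^(q+1) * 3^(2*k-(q+1))) *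
      ((∏ j : Fin m, P^(j:ℕ)) * (P^((3*(k:ℝ)-1)/2) * (LL μ)^(2*k))) := by
  have hL := LL_nonneg μ
  have hn : q+1 ≤ k := by omega
  have hmu : μ.real A ≤ 3*P*LL μ := by
    refine (measureReal_mono hAs).trans ?_
    have := mass_le μ (-P) (2*P) (by linarith)
    rw [show -P + 2*P = P by ring] at this
    refine this.trans (mul_le_mul_of_nonneg_right (by linarith) hL)
  have hKK : 0 ≤ KK q := by unfold KK; positivity
  have h0 := main_A k m q r hq hm hk P hP μ A hAm hA
  change ∫ α in BB m P, ‖FF m μ A α‖^(2*(q+1)) ≤ _ at h0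
  have h1 : ∫ α in BB m P, ‖FF m μ A α‖^(2*k) ≤ ∫ α in BB m P, (3*P*LL μ)^(2*k-2*(q+1)) * ‖FF m μ A α‖^(2*(q+1)) := by
    apply setIntegral_mono_on (BB_int m μ A P _) ((BB_int m μ A P _).const_mul _) (BB_compact m P).measurableSet
    intro α _
    rw [show ‖FF m μ A α‖^(2*k) = ‖FF m μ A α‖^(2*k-2*(q+1)) * ‖FF m μ A α‖^(2*(q+1)) by rw [← pow_add]; congr 1; omega]
    apply mul_le_mul_of_nonneg_right _ (by positivity)
    exact pow_le_pow_left₀ (norm_nonneg _) ((FF_le m μ A α).trans hmu) _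
  rw [integral_const_mul] at h1
  refine h1.trans ?_
  have hP0 : 0 < P := by linarith
  have hlam0 : 0 < lam k q P := by unfold lam; positivity
  have hCpsi : 0 ≤ (((q:ℝ)+1)*(Cpsi*lam k q P*LL μ))^(q+1) := by
    have h := (integral_nonneg (μ := μ) (f := fun s => 1/(1+((s-0)/lam k q P)^2)) (fun s => by positivity)).trans (psi_le μ 0 _ (lam_ge k q hq P hP))
    positivity
  have hlamn : (lam k q P)^(q+1) = P^((q:ℝ)+1-((k:ℝ)+1)/2) := by
    unfold lam
    rw [← Real.rpow_natCast, ← Real.rpow_mul hP0.le]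
    congr 1; push_cast; field_simp
  have hexp : P^(2*k-(q+1)) * (lam k q P)^(q+1) = P^((3*(k:ℝ)-1)/2) := by
    rw [hlamn, ← Real.rpow_natCast, ← Real.rpow_add hP0]
    congr 1
    rw [Nat.cast_sub (by omega)]
    push_cast; ring
  have hX : 0 ≤ 3*P*LL μ := by positivity
  calc _ ≤ (3*P*LL μ)^(2*k-2*(q+1)) * (Real.exp (π*m) * ((∏ j : Fin m, P^(j:ℕ)) * (KK q * ((((q:ℝ)+1)*(Cpsi*lam k q P*LL μ))^(q+1) * (3*P*LL μ)^(q+1))))) := by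
        refine mul_le_mul_of_nonneg_left (h0.trans ?_) (by positivity)
        gcongr
    _ = (Real.exp (π*m) * ((∏ j : Fin m, P^(j:ℕ)) * (KK q * ((((q:ℝ)+1)*(Cpsi*lam k q P*LL μ))^(q+1) * (3*P*LL μ)^(2*k-(q+1)))))) := by
        rw [show 2*k-(q+1) = (2*k-2*(q+1)) + (q+1) by omega, pow_add]; ring
    _ = _ := by
        rw [← hexp]
        rw [show (LL μ)^(2*k) = (LL μ)^(2*k-(q+1)) * (LL μ)^(q+1) by rw [← pow_add]; congr 1; omega]
        simp only [mul_pow]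
        ring

lemma part0 (k m : ℕ) (hk1 : 1 ≤ k) (P : ℝ) (hP : 1≤P) (μ : Measure ℝ) [IsProbabilityMeasure μ] :
    ∫ α in BB m P, ‖FF m μ (Ioc (-√P) (√P)) α‖^(2*k) ≤ (3^(2*k) * 2^m) *
      ((∏ j : Fin m, P^(j:ℕ)) * (P^((3*(k:ℝ)-1)/2) * (LL μ)^(2*k))) := by
  have hL := LL_nonneg μ
  have hP0 : 0 < P := by linarith
  have hs : 1 ≤ √P := Real.one_le_sqrt.mpr hP
  have hmu : μ.real (Ioc (-√P) (√P)) ≤ 3*√P*LL μ := by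
    have := mass_le μ (-√P) (2*√P) (by linarith)
    rw [show -√P + 2*√P = √P by ring] at this
    refine this.trans (mul_le_mul_of_nonneg_right (by linarith) hL)
  have hvol : volume.real (BB m P) = 2^m * ∏ j : Fin m, P^(j:ℕ) := by
    unfold BB
    rw [Set.pi_univ_Icc, Measure.real, Real.volume_Icc_pi_toReal]
    · have : ∀ j : Fin m, P^(j:ℕ) - -(P^(j:ℕ)) = 2*P^(j:ℕ) := fun j => by ring
      simp_rw [this]
      rw [Finset.prod_mul_distrib]; simp
    · intro j
      have : 0 < P^(j:ℕ) := by positivity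
      simp only []
      linarith
  have h1 : ∫ α in BB m P, ‖FF m μ (Ioc (-√P) (√P)) α‖^(2*k) ≤ ∫ α in BB m P, (3*√P*LL μ)^(2*k) := by
    apply setIntegral_mono_on (BB_int m μ _ P _) (continuous_const.continuousOn.integrableOn_compact (BB_compact m P)) (BB_compact m P).measurableSet
    intro α _
    exact pow_le_pow_left₀ (norm_nonneg _) ((FF_le m μ _ α).trans hmu) _
  refine h1.trans ?_
  rw [setIntegral_const, hvol, smul_eq_mul, mul_pow, mul_pow, pow_mul (√P), Real.sq_sqrt hP0.le]
  have h2 : P^k ≤ P^((3*(k:ℝ)-1)/2) := by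
    rw [← Real.rpow_natCast]
    apply Real.rpow_le_rpow_of_exponent_le hP
    have : (1:ℝ) ≤ k := by exact_mod_cast hk1
    linarith
  calc _ = (3^(2*k) * 2^m) * ((∏ j : Fin m, P^(j:ℕ)) * (P^k * (LL μ)^(2*k))) := by ring
    _ ≤ _ := by gcongr

lemma FF_split (m : ℕ) (P : ℝ) (hP : 1≤P) (μ : Measure ℝ) [IsProbabilityMeasure μ] (α : Fin m → ℝ) :
    FF m μ (Ioc (-P) P) α = FF m μ (Ioc (-P) (-√P)) α + FF m μ (Ioc (-√P) (√P)) α + FF m μ (Ioc (√P) P) α := by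
  have hs : 1 ≤ √P := Real.one_le_sqrt.mpr hP
  have hs2 : √P ≤ P := by
    have := Real.sq_sqrt (by linarith : (0:ℝ) ≤ P)
    nlinarith
  have hi : Integrable (fun s : ℝ => ee (∑ j : Fin m, α j * s^((j:ℕ)+1))) μ := by
    refine Integrable.mono' (integrable_const 1) (ee_cont.comp (by fun_prop : Continuous fun s : ℝ => ∑ j : Fin m, α j * s^((j:ℕ)+1))).aestronglyMeasurable (Filter.Eventually.of_forall fun s => (ee_norm _).le)
  unfold FF
  rw [← setIntegral_union (Ioc_disjoint_Ioc_of_le le_rfl) measurableSet_Ioc hi.integrableOn hi.integrableOn,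
    Ioc_union_Ioc_eq_Ioc (by linarith) (by linarith),
    ← setIntegral_union (Ioc_disjoint_Ioc_of_le le_rfl) measurableSet_Ioc hi.integrableOn hi.integrableOn,
    Ioc_union_Ioc_eq_Ioc (by linarith) (by linarith)]

lemma Ik_eq (μ : Measure ℝ) (m k : ℕ) (P : ℝ) :
    Ik μ m k P = P ^ (-(((m : ℝ) - 1) * m / 2)) * ∫ α in BB m P, ‖FF m μ (Ioc (-P) P) α‖^(2*k) := by
  unfold Ik FF
  simp_rw [integral_indicator measurableSet_Ioc]
  rfl

lemma W_eq (m : ℕ) (P : ℝ) (hP : 1 ≤ P) : P ^ (-(((m : ℝ) - 1) * m / 2)) * ∏ j : Fin m, P^(j:ℕ) = 1 := by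
  have hP0 : 0 < P := by linarith
  rw [Finset.prod_pow_eq_pow_sum, Fin.sum_univ_eq_sum_range (fun i => i), ← Real.rpow_natCast, ← Real.rpow_add hP0]
  have h := Finset.sum_range_id_mul_two m
  have h2 : ((∑ i ∈ Finset.range m, i : ℕ) : ℝ) * 2 = m * (m - 1) := by
    rcases m with _ | m
    · simp
    · have := congrArg (Nat.cast : ℕ → ℝ) h
      push_cast at this ⊢
      simpa using this
  rw [show -(((m : ℝ) - 1) * m / 2) + ((∑ i ∈ Finset.range m, i : ℕ) : ℝ) = 0 by linarith, Real.rpow_zero]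

lemma stmt_aux (m : ℕ) (hm : 2 < m) :
    ∀ k : ℕ, 1 ≤ k → k ≤ m →
      ∃ M : ℝ, 
        ∀ (μ : Measure ℝ), IsProbabilityMeasure μ →
        ∀ P : ℝ, 1 ≤ P →
          Ik μ m k P ≤
            M * (P ^ ((3 * (k : ℝ) - 1) / 2) * (LL μ) ^ (2 * k)) := by
  intro k hk1 hkm
  obtain ⟨q, hq⟩ : ∃ q, q = k/2 := ⟨_, rfl⟩
  obtain ⟨r, hr⟩ : ∃ r, r = m - (q+1) := ⟨_, rfl⟩
  have hmr : q+1+r ≤ m := by omega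
  have hkr : (k:ℝ)-1 ≤ 3*r := by
    have : k ≤ 3*r+1 := by omega
    have : (k:ℝ) ≤ ((3*r+1:ℕ):ℝ) := by exact_mod_cast this
    push_cast at this; linarith
  obtain ⟨CA, hCA⟩ : ∃ CA, CA = (Real.exp (π*m) * KK q * ((q+1)*Cpsi)^(q+1) * 3^(2*k-(q+1))) := ⟨_, rfl⟩
  refine ⟨3^(2*k) * (CA + 3^(2*k) * 2^m + CA), ?_⟩
  intro μ hμ P hP
  have hP0 : 0 < P := by linarith
  have hs : 1 ≤ √P := Real.one_le_sqrt.mpr hP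
  have hs2 : √P ≤ P := by
    have := Real.sq_sqrt (by linarith : (0:ℝ) ≤ P)
    nlinarith
  have h0 := part0 k m hk1 P hP μ
  have h1 := partA k m q r hk1 hq hmr hkr P hP μ (Ioc (√P) P) measurableSet_Ioc (Ioc_subset_Ioc (by linarith) le_rfl)
    (Or.inl fun x hx => ⟨hx.1.le, hx.2⟩)
  have h2 := partA k m q r hk1 hq hmr hkr P hP μ (Ioc (-P) (-√P)) measurableSet_Ioc (Ioc_subset_Ioc le_rfl (by linarith))
    (Or.inr fun x hx => ⟨by linarith [hx.2], by linarith [hx.1]⟩)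
  rw [← hCA] at h1 h2
  have h3 : ∫ α in BB m P, ‖FF m μ (Ioc (-P) P) α‖^(2*k) ≤
      ∫ α in BB m P, 3^(2*k) * (‖FF m μ (Ioc (-P) (-√P)) α‖^(2*k) + ‖FF m μ (Ioc (-√P) (√P)) α‖^(2*k) + ‖FF m μ (Ioc (√P) P) α‖^(2*k)) := by
    apply setIntegral_mono_on (BB_int m μ _ P _) ((((BB_int m μ _ P _).add (BB_int m μ _ P _)).add (BB_int m μ _ P _)).const_mul _) (BB_compact m P).measurableSet
    intro α _
    rw [FF_split m P hP]
    refine (pow_le_pow_left₀ (norm_nonneg _) (norm_add₃_le) _).trans (pow3 _ _ _ (norm_nonneg _) (norm_nonneg _) (norm_nonneg _) _)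
  have hii : Integrable (fun α => ‖FF m μ (Ioc (-P) (-√P)) α‖^(2*k) + ‖FF m μ (Ioc (-√P) (√P)) α‖^(2*k)) (volume.restrict (BB m P)) :=
    Integrable.add (BB_int m μ _ P _) (BB_int m μ _ P _)
  rw [integral_const_mul, integral_add hii (BB_int m μ _ P _),
    integral_add (BB_int m μ _ P _) (BB_int m μ _ P _)] at h3
  rw [Ik_eq]
  obtain ⟨Y, hY⟩ : ∃ Y, Y = P ^ ((3 * (k : ℝ) - 1) / 2) * (LL μ) ^ (2 * k) := ⟨_, rfl⟩
  rw [← hY] at h0 h1 h2 ⊢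
  have hW := W_eq m P hP
  calc _ ≤ P ^ (-(((m : ℝ) - 1) * m / 2)) * (3^(2*k) * (CA * ((∏ j : Fin m, P^(j:ℕ)) * Y) + (3^(2*k) * 2^m) * ((∏ j : Fin m, P^(j:ℕ)) * Y) + CA * ((∏ j : Fin m, P^(j:ℕ)) * Y))) := by
        apply mul_le_mul_of_nonneg_left _ (by positivity)
        refine h3.trans ?_
        apply mul_le_mul_of_nonneg_left _ (by positivity)
        linarith
    _ = (P ^ (-(((m : ℝ) - 1) * m / 2)) * ∏ j : Fin m, P^(j:ℕ)) * (3^(2*k) * (CA + 3^(2*k) * 2^m + CA) * Y) := by ring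
    _ = _ := by rw [hW, one_mul]

/-- (Theorem 10.) Let `m > 2` be an integer. For every integer `k` with
`1 ≤ k ≤ m` there is a constant `M_k` depending only on `k` and `m` such that for every
random variable `S` (with distribution `μ`) and every real `P ≥ 1`,
`I_k(P) ≤ M_k P^{(3k-1)/2} (sup_I P(S ∈ I))^{2k}`, where the sup is over all intervals
`I = (a, a+1]`. -/
theorem stmt_12 (m : ℕ) (hm : 2 < m) :
    ∀ k : ℕ, 1 ≤ k → k ≤ m →
      ∃ M : ℝ, 0 < M ∧
        ∀ (μ : Measure ℝ), IsProbabilityMeasure μ →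
        ∀ P : ℝ, 1 ≤ P →
          Ik μ m k P ≤
            M * P ^ ((3 * (k : ℝ) - 1) / 2) *
              (⨆ a : ℝ, (μ (Set.Ioc a (a + 1))).toReal) ^ (2 * k) := by
  intro k hk1 hkm
  obtain ⟨M, hM⟩ := stmt_aux m hm k hk1 hkm
  refine ⟨|M| + 1, by positivity, ?_⟩
  intro μ hμ P hP
  have hL := LL_nonneg μ
  have h := hM μ hμ P hP
  change Ik μ m k P ≤ (|M| + 1) * P ^ ((3 * (k : ℝ) - 1) / 2) * (LL μ) ^ (2 * k)
  rw [mul_assoc]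
  refine h.trans (mul_le_mul_of_nonneg_right ?_ (by positivity))
  have := le_abs_self M
  linarith
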